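/- Let k ≥ 2 and r ≥ 1 be integers, set n := k + r, and let a₀, …, a_n be a sequence with a₀ = a₁ = ⋯ = a_k = k and a_{k+j} ≥ k for every 1 ≤ j ≤ r. Let f be the associated minimal Conley–Zehnder index function. Then f(k) = r − k + 3, and f(T) ≥ r − k + 3 for every integer T ≥ k; consequently the minimal SFT degree satisfies f(T) + n − 3 ≥ 2r > 0 for all T ≥ k. -/

import Mathlib

/-!
STATEMENT 15: Let k ≥ 2 and r ≥ 1 be integers, set n := k + r, and let a₀, …, a_n be a
sequence with a₀ = a₁ = ⋯ = a_k = k and a_{k+j} ≥ k for every 1 ≤ j ≤ r.  Let f be the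
associated minimal Conley–Zehnder index function.  Then f(k) = r − k + 3, and
f(T) ≥ r − k + 3 for every integer T ≥ k; consequently the minimal SFT degree
satisfies f(T) + n − 3 ≥ 2r > 0 for all T ≥ k.
-/

open Finset

/-- `I_T := {i ∈ {0, …, n} : aᵢ ∣ T}`. -/
def brieskornI (n : ℕ) (a : Fin (n + 1) → ℕ) (T : ℕ) : Finset (Fin (n + 1)) :=
  Finset.univ.filter fun i => a i ∣ T

/-- `f(T) := 2∑_{i=0}^{n} ⌊T/aᵢ⌋ + n + 3 − 2|I_T| − 2T ∈ ℤ`, the minimal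
Conley–Zehnder index formula for Brieskorn manifolds. -/
def brieskornF (n : ℕ) (a : Fin (n + 1) → ℕ) (T : ℕ) : ℤ :=
  2 * (∑ i : Fin (n + 1), ((T / a i : ℕ) : ℤ)) + (n : ℤ) + 3 -
    2 * ((brieskornI n a T).card : ℤ) - 2 * (T : ℤ)

/-- Dropping the divisibility correction amounts to replacing `T` by `T - 1`. -/
theorem brieskornF_succ (n : ℕ) (a : Fin (n + 1) → ℕ) (S : ℕ) :
    brieskornF n a (S + 1) =
      2 * (∑ i : Fin (n + 1), ((S / a i : ℕ) : ℤ)) + (n : ℤ) + 1 - 2 * (S : ℤ) := by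
  have h : ∑ i : Fin (n + 1), (((S + 1) / a i : ℕ) : ℤ) =
      ∑ i : Fin (n + 1), ((S / a i : ℕ) : ℤ) + ((brieskornI n a (S + 1)).card : ℤ) := by
    simp only [Nat.succ_div, brieskornI, Finset.card_filter, Nat.cast_add, Nat.cast_sum,
      Finset.sum_add_distrib]
  rw [brieskornF, h]
  push_cast
  ring

/-- If the first `k + 1` exponents equal `k`, they contribute `(k + 1) ⌊S/k⌋` to the sum. -/
theorem mul_div_le_sum_div (k r S : ℕ) (a : Fin (k + r + 1) → ℕ)
    (ha : ∀ i : Fin (k + r + 1), (i : ℕ) ≤ k → a i = k) :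
    ((k : ℤ) + 1) * ((S / k : ℕ) : ℤ) ≤ ∑ i : Fin (k + r + 1), ((S / a i : ℕ) : ℤ) := by
  have hc : (univ.filter fun i : Fin (k + r + 1) => (i : ℕ) ≤ k).card = k + 1 := by
    have h := Fin.card_Iic (⟨k, by omega⟩ : Fin (k + r + 1))
    rw [← h]
    congr 1
    ext i
    simp [Fin.le_def]
  calc ((k : ℤ) + 1) * ((S / k : ℕ) : ℤ)
      = ∑ i ∈ univ.filter (fun i : Fin (k + r + 1) => (i : ℕ) ≤ k), ((S / a i : ℕ) : ℤ) := by
        rw [Finset.sum_congr rfl (g := fun _ => ((S / k : ℕ) : ℤ)), Finset.sum_const, hc]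
        · simp
        · intro i hi
          rw [ha i (Finset.mem_filter.mp hi).2]
    _ ≤ _ := Finset.sum_le_sum_of_subset_of_nonneg (Finset.filter_subset _ _)
        fun _ _ _ => Int.natCast_nonneg _

theorem stmt_15 (k r : ℕ) (hk : 2 ≤ k) (hr : 1 ≤ r) (n : ℕ) (hn : n = k + r)
    (a : Fin (n + 1) → ℕ)
    (ha1 : ∀ i : Fin (n + 1), (i : ℕ) ≤ k → a i = k)
    (ha2 : ∀ i : Fin (n + 1), k < (i : ℕ) → k ≤ a i) :
    brieskornF n a k = (r : ℤ) - (k : ℤ) + 3 ∧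
    (∀ T : ℕ, k ≤ T → (r : ℤ) - (k : ℤ) + 3 ≤ brieskornF n a T) ∧
    (∀ T : ℕ, k ≤ T → 2 * (r : ℤ) ≤ brieskornF n a T + (n : ℤ) - 3) ∧
    0 < 2 * (r : ℤ) := by
  subst hn
  have bound : ∀ T : ℕ, k ≤ T → (r : ℤ) - (k : ℤ) + 3 ≤ brieskornF (k + r) a T := by
    intro T hT
    obtain ⟨S, rfl⟩ : ∃ S, T = S + 1 := ⟨T - 1, by omega⟩
    rw [brieskornF_succ]
    have hsum := mul_div_le_sum_div k r S a ha1
    have hlt : (S : ℤ) + 1 ≤ k * ((S / k : ℕ) : ℤ) + k := by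
      exact_mod_cast Nat.lt_mul_div_succ S (by omega : 0 < k)
    have hq : (0 : ℤ) ≤ ((S / k : ℕ) : ℤ) := Int.natCast_nonneg _
    rw [Nat.cast_add]
    linarith
  refine ⟨?_, bound, fun T hT => ?_, by omega⟩
  · obtain ⟨m, rfl⟩ : ∃ m, k = m + 1 := ⟨k - 1, by omega⟩
    have hz : ∀ i, m / a i = 0 := fun i => by
      refine Nat.div_eq_of_lt ?_
      rcases le_or_gt (i : ℕ) (m + 1) with h | h
      · rw [ha1 i h]
        omega
      · exact ha2 i h
    rw [brieskornF_succ]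
    simp only [hz]
    push_cast
    simp
    ring
  · have := bound T hT
    push_cast
    linarith
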